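/- Let 1 ≤ ℓ ≤ n be integers and let X be a random ℓ×n real matrix whose ℓn entries are i.i.d. standard normal random variables. Then E[√(det(X Xᵀ))] = 2^{ℓ/2} · Γ_ℓ((n+1)/2) / Γ_ℓ(n/2). -/

import Mathlib

open MeasureTheory ProbabilityTheory Matrix

noncomputable section

/-- The multivariate Gamma function `Γ_ℓ(a) = π^{ℓ(ℓ-1)/4} ∏_{i=1}^{ℓ} Γ(a - (i-1)/2)`. -/
def multivariateGamma (ℓ : ℕ) (a : ℝ) : ℝ :=
  Real.pi ^ ((ℓ : ℝ) * ((ℓ : ℝ) - 1) / 4) *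
    ∏ i ∈ Finset.range ℓ, Real.Gamma (a - (i : ℝ) / 2)

instance matrixMeasurableSpace (ℓ n : ℕ) : MeasurableSpace (Matrix (Fin ℓ) (Fin n) ℝ) :=
  inferInstanceAs (MeasurableSpace (Fin ℓ → Fin n → ℝ))

/-- The law of an `ℓ × n` random matrix whose `ℓn` entries are i.i.d. standard normal. -/
def stdGaussianMatrix (ℓ n : ℕ) : Measure (Matrix (Fin ℓ) (Fin n) ℝ) :=
  Measure.pi fun _ : Fin ℓ => Measure.pi fun _ : Fin n => gaussianReal 0 1


namespace GaussDet

open Module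
open scoped RealInnerProductSpace

section gen
variable {E : Type*} [NormedAddCommGroup E] [InnerProductSpace ℝ E] [FiniteDimensional ℝ E]
  [MeasurableSpace E] [BorelSpace E]

lemma stdGaussian_eq_withDensity :
    stdGaussian E = (volume : Measure E).withDensity (fun x => ENNReal.ofReal
      (((2 * Real.pi) ^ ((finrank ℝ E : ℝ) / 2))⁻¹ * Real.exp (-(1/2) * ‖x‖ ^ 2))) := by
  set C : ℝ := (2 * Real.pi) ^ ((finrank ℝ E : ℝ) / 2) with hC
  have hCpos : 0 < C := by positivity
  have hint : ∫ x : E, Real.exp (-(1/2) * ‖x‖ ^ 2) = C := by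
    rw [GaussianFourier.integral_rexp_neg_mul_sq_norm (by norm_num), hC]
    congr 1; ring
  have hI : Integrable (fun x : E => Real.exp (-(1/2) * ‖x‖ ^ 2)) := by
    by_contra h
    rw [integral_undef h] at hint
    exact hCpos.ne hint
  have hfin : IsFiniteMeasure ((volume : Measure E).withDensity (fun x => ENNReal.ofReal
      (C⁻¹ * Real.exp (-(1/2) * ‖x‖ ^ 2)))) :=
    isFiniteMeasure_withDensity_ofReal (hI.const_mul _).2
  apply Measure.ext_of_charFun
  ext t
  rw [charFun_stdGaussian, charFun_apply, integral_withDensity_eq_integral_toReal_smul₀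
    (by fun_prop) (by simp)]
  have h := GaussianFourier.integral_cexp_neg_mul_sq_norm_add (V := E) (b := ((1/2 : ℝ) : ℂ))
    (by simp) Complex.I t
  have h2 : ∀ x : E, (ENNReal.ofReal (C⁻¹ * Real.exp (-(1/2) * ‖x‖ ^ 2))).toReal •
      Complex.exp ((⟪x, t⟫ : ℝ) * Complex.I) = (C⁻¹ : ℂ) *
        Complex.exp (-((1/2 : ℝ) : ℂ) * ‖x‖ ^ 2 + Complex.I * (⟪t, x⟫ : ℝ)) := by
    intro x
    rw [ENNReal.toReal_ofReal (by positivity), Complex.exp_add, real_inner_comm x t,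
      mul_comm Complex.I, Complex.real_smul]
    push_cast
    ring
  simp_rw [h2]
  rw [integral_const_mul, h, hC]
  have h3 : ((Real.pi : ℂ) / ((1/2 : ℝ) : ℂ)) ^ ((finrank ℝ E : ℂ) / 2) = (C : ℂ) := by
    rw [hC, Complex.ofReal_cpow (by positivity)]
    push_cast
    congr 1
    ring
  rw [h3, ← hC, ← mul_assoc, inv_mul_cancel₀ (by exact_mod_cast hCpos.ne'), one_mul]
  congr 1
  rw [Complex.I_sq]
  push_cast
  ring

lemma integral_norm_stdGaussian (hd : 0 < finrank ℝ E) :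
    ∫ x : E, ‖x‖ ∂(stdGaussian E) = Real.sqrt 2 *
      Real.Gamma (((finrank ℝ E : ℝ) + 1) / 2) / Real.Gamma ((finrank ℝ E : ℝ) / 2) := by
  have : Nontrivial E := Module.finrank_pos_iff.mp hd
  set d := finrank ℝ E with hdef
  set C : ℝ := (2 * Real.pi) ^ ((d : ℝ) / 2) with hC
  have hCpos : 0 < C := by positivity
  have key : ∀ f : ℝ → ℝ, ∫ x : E, f ‖x‖ ∂(stdGaussian E) =
      (d * (volume : Measure E).real (Metric.ball 0 1) * C⁻¹) * 
       ∫ y in Set.Ioi (0:ℝ), y ^ (d - 1) * (Real.exp (-(1/2) * y ^ 2) * f y) := by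
    intro f
    rw [stdGaussian_eq_withDensity, integral_withDensity_eq_integral_toReal_smul₀
      (by fun_prop) (by simp)]
    have := integral_fun_norm_addHaar (volume : Measure E)
      (fun y => C⁻¹ * (Real.exp (-(1/2) * y ^ 2) * f y))
    simp only [smul_eq_mul, nsmul_eq_mul] at this
    rw [mul_assoc, mul_assoc, ← integral_const_mul]
    simp_rw [mul_left_comm (C⁻¹)]
    simp_rw [mul_left_comm (C⁻¹)] at this
    rw [← this]
    congr 1
    ext x
    rw [ENNReal.toReal_ofReal (by positivity), smul_eq_mul]
    ring
  have hd1 : (((d - 1 : ℕ) : ℕ) : ℝ) = (d : ℝ) - 1 := by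
    rw [Nat.cast_sub hd]; simp
  have hdR : (0 : ℝ) < d := by exact_mod_cast hd
  have i0 : ∫ y in Set.Ioi (0:ℝ), y ^ (d - 1) * (Real.exp (-(1/2) * y ^ 2) * 1) =
      (1/2 : ℝ) ^ (-(d : ℝ) / 2) * (1 / 2) * Real.Gamma ((d : ℝ) / 2) := by
    have := integral_rpow_mul_exp_neg_mul_rpow (p := 2) (q := (d : ℝ) - 1) (b := 1/2)
      (by norm_num) (by linarith) (by norm_num)
    simp only [sub_add_cancel] at this
    rw [← this]
    refine setIntegral_congr_fun measurableSet_Ioi fun y hy => ?_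
    simp only [mul_one, Real.rpow_two]
    rw [← hd1, Real.rpow_natCast]
  have i1 : ∫ y in Set.Ioi (0:ℝ), y ^ (d - 1) * (Real.exp (-(1/2) * y ^ 2) * y) =
      (1/2 : ℝ) ^ (-((d : ℝ) + 1) / 2) * (1 / 2) * Real.Gamma (((d : ℝ) + 1) / 2) := by
    have := integral_rpow_mul_exp_neg_mul_rpow (p := 2) (q := (d : ℝ)) (b := 1/2)
      (by norm_num) (by linarith) (by norm_num)
    rw [← this]
    refine setIntegral_congr_fun measurableSet_Ioi fun y hy => ?_
    simp only [Real.rpow_two, Real.rpow_natCast]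
    obtain ⟨k, hk⟩ : ∃ k, d = k + 1 := ⟨d - 1, by omega⟩
    rw [hk, pow_succ]; simp; ring
  have k0 := key (fun _ => 1)
  have k1 := key (fun y => y)
  simp only [i0, i1] at k0 k1
  rw [k1]
  simp only [integral_const, probReal_univ, smul_eq_mul, mul_one] at k0
  have hG : 0 < Real.Gamma ((d : ℝ) / 2) := Real.Gamma_pos_of_pos (by positivity)
  have hs : (1/2 : ℝ) ^ (-((d : ℝ) + 1) / 2) = (1/2 : ℝ) ^ (-(d : ℝ) / 2) * Real.sqrt 2 := by
    rw [show -((d : ℝ) + 1) / 2 = -(d : ℝ) / 2 + -(1 / 2) by ring, Real.rpow_add (by norm_num)]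
    congr 1
    rw [Real.rpow_neg (by norm_num), ← Real.inv_rpow (by norm_num), Real.sqrt_eq_rpow]
    norm_num
  rw [hs, eq_div_iff hG.ne']
  generalize (↑d * volume.real (Metric.ball (0:E) 1) * C⁻¹) = A at *
  linear_combination (-(Real.sqrt 2) * Real.Gamma (((d : ℝ) + 1) / 2)) * k0

lemma lintegral_norm_stdGaussian (hd : 0 < finrank ℝ E) :
    ∫⁻ x : E, ENNReal.ofReal ‖x‖ ∂(stdGaussian E) = ENNReal.ofReal (Real.sqrt 2 *
      Real.Gamma (((finrank ℝ E : ℝ) + 1) / 2) / Real.Gamma ((finrank ℝ E : ℝ) / 2)) := by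
  rw [← integral_norm_stdGaussian hd, ofReal_integral_eq_lintegral_ofReal]
  · exact IsGaussian.integrable_id.norm
  · filter_upwards with x using norm_nonneg x

lemma map_proj (K : Submodule ℝ E) :
    (stdGaussian E).map K.orthogonalProjectionOnto = stdGaussian K := by
  have : IsProbabilityMeasure ((stdGaussian E).map K.orthogonalProjectionOnto) :=
    Measure.isProbabilityMeasure_map (by fun_prop)
  apply Measure.ext_of_charFun
  ext t
  have h := charFun_stdGaussian (E := E) (t : E)
  rw [charFun_stdGaussian, charFun_apply, integral_map (by fun_prop)
    (Measurable.aestronglyMeasurable (by fun_prop))]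
  rw [charFun_apply] at h
  rw [Submodule.coe_norm] at *
  rw [← h]
  congr 1
  ext x
  rw [Submodule.inner_orthogonalProjectionOnto_eq_of_mem_right]

end gen

section gram
variable {E : Type*} [NormedAddCommGroup E] [InnerProductSpace ℝ E] [FiniteDimensional ℝ E]

lemma det_gram_cons {k : ℕ} (x : E) (v : Fin k → E) :
    (gram ℝ (Fin.cons x v : Fin (k+1) → E)).det =
      ‖(Submodule.span ℝ (Set.range v))ᗮ.orthogonalProjectionOnto x‖ ^ 2 * (gram ℝ v).det := by
  set K := Submodule.span ℝ (Set.range v) with hK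
  set p : E := ↑(K.orthogonalProjectionOnto x) with hp
  set q : E := ↑(Kᗮ.orthogonalProjectionOnto x) with hq
  have hxpq : x = p + q := by
    rw [hp, hq]
    exact (Submodule.starProjection_add_starProjection_orthogonal (K := K) x).symm
  have hpK : p ∈ K := Submodule.coe_mem _
  have hqK : q ∈ Kᗮ := Submodule.coe_mem _
  have hqv : ∀ i, ⟪q, v i⟫ = 0 := fun i =>
    Submodule.inner_left_of_mem_orthogonal (K := K) (Submodule.subset_span (Set.mem_range_self i)) hqK
  obtain ⟨c, hc⟩ := (Submodule.mem_span_range_iff_exists_fun ℝ).mp hpK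
  have hqx : ⟪q, x⟫ = ‖q‖ ^ 2 := by
    rw [hxpq, inner_add_right, Submodule.inner_left_of_mem_orthogonal hpK hqK, zero_add,
      real_inner_self_eq_norm_sq]
  set G := gram ℝ (Fin.cons x v : Fin (k+1) → E) with hG
  have hrow : (G.updateRow 0 (fun j => ⟪q, (Fin.cons x v : Fin (k+1) → E) j⟫)).det = G.det := by
    have h1 : (fun j => ⟪q, (Fin.cons x v : Fin (k+1) → E) j⟫) =
        ∑ i, (Fin.cons 1 (fun i => -c i) : Fin (k+1) → ℝ) i • G i := by
      ext j
      have : q = x - ∑ i, c i • v i := by rw [hc, hxpq]; abel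
      rw [this, inner_sub_left, sum_inner]
      simp [hG, gram_apply, inner_smul_left, Fin.sum_univ_succ, sub_eq_add_neg]
    rw [h1, det_updateRow_sum]
    simp
  rw [← hrow, det_succ_row_zero, Fin.sum_univ_succ]
  have hs : (G.updateRow 0 (fun j => ⟪q, (Fin.cons x v : Fin (k+1) → E) j⟫)).submatrix
      Fin.succ (Fin.succAbove 0) = gram ℝ v := by
    ext i j
    simp [hG, gram_apply]
  rw [hs]
  simp [hqv, hqx, ← hq]

end gram

/-- The Gaussian law of a row. -/
abbrev rowLaw (n : ℕ) : Measure (Fin n → ℝ) := Measure.pi fun _ : Fin n => gaussianReal 0 1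

/-- Square root of the Gram determinant of a family of rows. -/
def vol (n k : ℕ) (X : Fin k → Fin n → ℝ) : ℝ :=
  Real.sqrt (gram ℝ (fun i => (WithLp.toLp 2 (X i) : EuclideanSpace ℝ (Fin n)))).det

/-- Mean of the chi distribution. -/
def chiMean (d : ℝ) : ℝ := Real.sqrt 2 * Real.Gamma ((d + 1) / 2) / Real.Gamma (d / 2)

lemma vol_eq (n k : ℕ) (X : Matrix (Fin k) (Fin n) ℝ) :
    vol n k X = Real.sqrt (X * Xᵀ).det := by
  unfold vol
  congr 2
  ext i j
  simp [gram_apply, Matrix.mul_apply, PiLp.inner_apply, mul_comm]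

lemma continuous_vol (n k : ℕ) : Continuous (vol n k) := by
  have : vol n k = fun X : Matrix (Fin k) (Fin n) ℝ => Real.sqrt (X * Xᵀ).det := by
    ext X; exact vol_eq n k X
  rw [this]
  exact Real.continuous_sqrt.comp
    ((continuous_id.matrix_mul continuous_id.matrix_transpose).matrix_det)

lemma lintegral_row (n k : ℕ) (hk : k < n) (Y : Fin k → Fin n → ℝ) :
    ∫⁻ x, ENNReal.ofReal (vol n (k+1) (Fin.cons x Y)) ∂(rowLaw n) =
      ENNReal.ofReal (chiMean ((n : ℝ) - k)) * ENNReal.ofReal (vol n k Y) := by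
  set v : Fin k → EuclideanSpace ℝ (Fin n) := fun i => WithLp.toLp 2 (Y i) with hv
  set K := Submodule.span ℝ (Set.range v) with hK
  have h1 : ∀ x : Fin n → ℝ, vol n (k+1) (Fin.cons x Y) =
      ‖Kᗮ.orthogonalProjectionOnto (WithLp.toLp 2 x)‖ * vol n k Y := by
    intro x
    have : (fun i => (WithLp.toLp 2 ((Fin.cons x Y : Fin (k+1) → Fin n → ℝ) i) :
        EuclideanSpace ℝ (Fin n))) = Fin.cons (WithLp.toLp 2 x) v := by
      ext i
      refine Fin.cases ?_ (fun i => ?_) i <;> simp [hv]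
    rw [vol, this, det_gram_cons, Real.sqrt_mul (by positivity), Real.sqrt_sq (norm_nonneg _)]
    rfl
  simp_rw [h1, ENNReal.ofReal_mul (norm_nonneg _)]
  rw [lintegral_mul_const _ (by fun_prop)]
  by_cases h0 : vol n k Y = 0
  · simp [h0]
  congr 1
  have hdet : (gram ℝ v).det ≠ 0 := by
    intro h
    apply h0
    rw [vol, h, Real.sqrt_zero]
  have hli := linearIndependent_of_det_gram_ne_zero hdet
  have hfr : finrank ℝ K = k := by
    rw [hK, finrank_span_eq_card hli, Fintype.card_fin]
  have hfr2 : finrank ℝ Kᗮ = n - k := by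
    have := Submodule.finrank_add_finrank_orthogonal K
    rw [finrank_euclideanSpace_fin] at this
    omega
  have hfr3 : (finrank ℝ Kᗮ : ℝ) = (n : ℝ) - k := by
    rw [hfr2, Nat.cast_sub hk.le]
  have hm := lintegral_norm_stdGaussian (E := Kᗮ) (by omega)
  rw [hfr3] at hm
  rw [chiMean, ← hm, ← map_proj, ← map_pi_eq_stdGaussian, lintegral_map (by fun_prop) (by fun_prop),
    lintegral_map (by fun_prop) (by fun_prop)]

lemma lintegral_vol (n k : ℕ) (hk : k ≤ n) :
    ∫⁻ X, ENNReal.ofReal (vol n k X) ∂(Measure.pi fun _ : Fin k => rowLaw n) =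
      ENNReal.ofReal (∏ i ∈ Finset.range k, chiMean ((n : ℝ) - i)) := by
  induction k with
  | zero => simp [vol]
  | succ k ih =>
    have mp := (measurePreserving_piFinSuccAbove (fun _ : Fin (k+1) => rowLaw n) 0).symm
    rw [← mp.lintegral_comp (continuous_vol n (k+1)).measurable.ennreal_ofReal]
    rw [lintegral_prod_symm (fun z => ENNReal.ofReal (vol n (k+1)
      ((MeasurableEquiv.piFinSuccAbove (fun _ : Fin (k+1) => Fin n → ℝ) 0).symm z))) (((continuous_vol n (k+1)).measurable.ennreal_ofReal).comp
      mp.measurable).aemeasurable]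
    have h : ∀ (x : Fin n → ℝ) (Y : Fin k → Fin n → ℝ),
        (MeasurableEquiv.piFinSuccAbove (fun _ : Fin (k+1) => Fin n → ℝ) 0).symm (x, Y) =
          Fin.cons x Y := by
      intro x Y
      rw [← Fin.insertNth_zero']
      rfl
    simp_rw [h, lintegral_row n k (by omega)]
    rw [lintegral_const_mul _ (continuous_vol n k).measurable.ennreal_ofReal, ih (by omega),
      Finset.prod_range_succ, mul_comm (∏ i ∈ _, _), ENNReal.ofReal_mul]
    have : (k : ℝ) + 1 ≤ n := by exact_mod_cast hk
    have h1 := Real.Gamma_pos_of_pos (s := ((n:ℝ) - k + 1) / 2) (by linarith)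
    have h2 := Real.Gamma_pos_of_pos (s := ((n:ℝ) - k) / 2) (by linarith)
    unfold chiMean
    positivity

lemma chiMean_nonneg {d : ℝ} (hd : 0 < d) : 0 ≤ chiMean d := by
  have h1 := Real.Gamma_pos_of_pos (s := (d + 1) / 2) (by linarith)
  have h2 := Real.Gamma_pos_of_pos (s := d / 2) (by linarith)
  unfold chiMean
  positivity

end GaussDet

/-- If `X` is an `ℓ × n` matrix with i.i.d. standard normal entries
(`1 ≤ ℓ ≤ n`), then `E[√(det (X Xᵀ))] = 2^{ℓ/2} Γ_ℓ((n+1)/2) / Γ_ℓ(n/2)`. -/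
theorem statement_0 (ℓ n : ℕ) (hℓ : 1 ≤ ℓ) (hn : ℓ ≤ n) :
    ∫ X : Matrix (Fin ℓ) (Fin n) ℝ, Real.sqrt (X * Xᵀ).det ∂(stdGaussianMatrix ℓ n)
      = (2 : ℝ) ^ ((ℓ : ℝ) / 2) *
        multivariateGamma ℓ (((n : ℝ) + 1) / 2) / multivariateGamma ℓ ((n : ℝ) / 2) := by
  have h1 : ∫ X : Matrix (Fin ℓ) (Fin n) ℝ, Real.sqrt (X * Xᵀ).det ∂(stdGaussianMatrix ℓ n) =
      ∫ X : Fin ℓ → Fin n → ℝ, GaussDet.vol n ℓ X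
        ∂(Measure.pi fun _ : Fin ℓ => GaussDet.rowLaw n) := by
    simp_rw [← GaussDet.vol_eq]
    rfl
  rw [h1, integral_eq_lintegral_of_nonneg_ae (f := GaussDet.vol n ℓ)
    (Filter.Eventually.of_forall fun X => Real.sqrt_nonneg _)
    (GaussDet.continuous_vol n ℓ).measurable.aestronglyMeasurable, GaussDet.lintegral_vol n ℓ hn,
    ENNReal.toReal_ofReal]
  · unfold GaussDet.chiMean multivariateGamma
    rw [Finset.prod_div_distrib, Finset.prod_mul_distrib, Finset.prod_const, Finset.card_range]
    have e1 : Real.sqrt 2 ^ ℓ = (2 : ℝ) ^ ((ℓ : ℝ) / 2) := by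
      rw [Real.sqrt_eq_rpow, ← Real.rpow_natCast, ← Real.rpow_mul (by norm_num)]
      congr 1; ring
    have e2 : ∀ i : ℕ, ((n : ℝ) - i + 1) / 2 = ((n : ℝ) + 1) / 2 - i / 2 := fun i => by ring
    have e3 : ∀ i : ℕ, ((n : ℝ) - i) / 2 = (n : ℝ) / 2 - i / 2 := fun i => by ring
    simp_rw [e1, e2, e3]
    have hp : Real.pi ^ ((ℓ : ℝ) * ((ℓ : ℝ) - 1) / 4) ≠ 0 := by positivity
    rw [mul_left_comm, mul_div_mul_left _ _ hp]
  · refine Finset.prod_nonneg fun i hi => GaussDet.chiMean_nonneg ?_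
    have : i < n := (Finset.mem_range.mp hi).trans_le hn
    have : (i : ℝ) < n := by exact_mod_cast this
    linarith
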